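/- Fix d ≥ 1, t > 0, and ε > 0. Let f⃗: ℝ^d → ℝ^d be such that for every unit vector w ∈ ℝ^d and every b ∈ ℝ^d the line restriction x ↦ f⃗(wx + b) is continuous and differentiable except at finitely many points. If L^{(d)}_t[f⃗] < ε, then there exists g: ℝ → ℝ, continuous and differentiable except at finitely many points, such that L_t[g] < ε and R[g] ≤ R^{(d)}[f⃗]. -/

import Mathlib

open MeasureTheory Real Set Filter
open scoped ENNReal

/-- Centered Gaussian density with standard deviation `σ`. -/
noncomputable def gaussD (x σ : ℝ) : ℝ :=
  (Real.sqrt (2 * Real.pi) * σ)⁻¹ * Real.exp (-x ^ 2 / (2 * σ ^ 2))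

/-- Training points `y_k = 2(k-1)Δ - D`, `Δ = D/(n-1)`. -/
noncomputable def trainPt (n : ℕ) (D : ℝ) (k : ℕ) : ℝ :=
  2 * ((k : ℝ) - 1) * (D / ((n : ℝ) - 1)) - D

/-- Noised empirical density `p_t`. -/
noncomputable def pEmp (n : ℕ) (D t x : ℝ) : ℝ :=
  (1 / (n : ℝ)) * ∑ k ∈ Finset.Icc 1 n, gaussD (x - trainPt n D k) (Real.sqrt t)

/-- Empirical score function `(d/dx) log p_t`. -/
noncomputable def scoreEmp (n : ℕ) (D t x : ℝ) : ℝ :=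
  deriv (fun y => Real.log (pEmp n D t y)) x

/-- Score matching loss `L_t[f]`. -/
noncomputable def scoreLoss (n : ℕ) (D t : ℝ) (f : ℝ → ℝ) : ℝ :=
  t * ∫ x, |f x - scoreEmp n D t x| ^ 2 * pEmp n D t x

/-- `F(κ) = 2 ∫_κ^∞ (u-κ)² p_N(u;1) du`. -/
noncomputable def Fgauss (κ : ℝ) : ℝ :=
  2 * ∫ u in Set.Ioi κ, (u - κ) ^ 2 * gaussD u 1

/-- The smoothed piecewise-linear empirical score function `ŝ_{t,δ}` (as a predicate
characterizing it by its defining piecewise formulas). -/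
def IsShat (n : ℕ) (D t δ : ℝ) (s : ℝ → ℝ) : Prop :=
  (∀ x ≤ trainPt n D 1 + δ, s x = (trainPt n D 1 - x) / t) ∧
  (∀ x, trainPt n D n - δ ≤ x → s x = (trainPt n D n - x) / t) ∧
  (∀ k, 2 ≤ k → k ≤ n - 1 →
    ∀ x ∈ Set.Icc (trainPt n D k - δ) (trainPt n D k + δ),
      s x = (trainPt n D k - x) / t) ∧
  (∀ k, 1 ≤ k → k ≤ n - 1 →
    ∀ x ∈ Set.Icc (trainPt n D k + δ) (trainPt n D (k + 1) - δ),
      s x = (δ / (D / ((n : ℝ) - 1) - δ)) * (x - (trainPt n D k + D / ((n : ℝ) - 1))) / t)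

/-- Non-smoothness measure `R[f]`: the total variation over ℝ of the derivative `f'`
(taken over the set where `f` is differentiable). -/
noncomputable def Rns (f : ℝ → ℝ) : ℝ≥0∞ :=
  eVariationOn (deriv f) {x | DifferentiableAt ℝ f x}

/-- The `(d+1)`-dimensional noised empirical density
`p^{(d)}_t(x) = p_t(x₁) ∏_{i≥2} p_N(x_i; √t)`. -/
noncomputable def pEmpD (n : ℕ) (D : ℝ) (d : ℕ) (t : ℝ)
    (x : EuclideanSpace ℝ (Fin (d + 1))) : ℝ :=
  pEmp n D t (x 0) *
    ∏ i ∈ Finset.univ.erase (0 : Fin (d + 1)), gaussD (x i) (Real.sqrt t)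

/-- The `(d+1)`-dimensional score matching loss
`L^{(d)}_t[f] = t ∫ ‖f(x) - ∇ log p^{(d)}_t(x)‖² p^{(d)}_t(x) dx`. -/
noncomputable def scoreLossD (n : ℕ) (D : ℝ) (d : ℕ) (t : ℝ)
    (f : EuclideanSpace ℝ (Fin (d + 1)) → EuclideanSpace ℝ (Fin (d + 1))) : ℝ :=
  t * ∫ x, ‖f x - gradient (fun y => Real.log (pEmpD n D d t y)) x‖ ^ 2 * pEmpD n D d t x

/-- The `(d+1)`-dimensional non-smoothness measure `R^{(d)}[f]`: the supremum over unit
vectors `w` and offsets `b` of the total variation over ℝ of the derivative of the line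
restriction `x ↦ f(wx + b)`. -/
noncomputable def RnsD (d : ℕ)
    (f : EuclideanSpace ℝ (Fin (d + 1)) → EuclideanSpace ℝ (Fin (d + 1))) : ℝ≥0∞ :=
  ⨆ (w : EuclideanSpace ℝ (Fin (d + 1))) (_ : ‖w‖ = 1)
    (b : EuclideanSpace ℝ (Fin (d + 1))),
    eVariationOn (deriv fun x : ℝ => f (x • w + b))
      {x | DifferentiableAt ℝ (fun x : ℝ => f (x • w + b)) x}

theorem norm_sub_le_of_norm_deriv_le_off_countable {F : Type*} [NormedAddCommGroup F]
    [NormedSpace ℝ F] [FiniteDimensional ℝ F] {h : ℝ → F} {s : Set ℝ} {M : ℝ}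
    (hc : Continuous h) (hs : s.Countable) (hd : ∀ x ∉ s, DifferentiableAt ℝ h x)
    (hM : ∀ x ∉ s, ‖deriv h x‖ ≤ M) (a b : ℝ) : ‖h b - h a‖ ≤ M * |b - a| := by
  have : CompleteSpace F := FiniteDimensional.complete ℝ F
  have hae : ∀ᵐ x : ℝ, ‖deriv h x‖ ≤ M := by
    filter_upwards [hs.ae_notMem volume] with x hx using hM x hx
  have hint : IntervalIntegrable (deriv h) volume a b := by
    refine (intervalIntegrable_const (c := M)).mono_fun
      (stronglyMeasurable_deriv h).aestronglyMeasurable ?_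
    filter_upwards [ae_restrict_of_ae hae] with x hx using hx.trans (le_abs_self M)
  rw [← MeasureTheory.integral_eq_of_hasDerivAt_off_countable h (deriv h) hs hc.continuousOn
    (fun x hx => (hd x hx.2).hasDerivAt) hint]
  refine intervalIntegral.norm_integral_le_of_norm_le_const_ae ?_
  filter_upwards [hae] with x hx _ using hx

/-- A function whose derivative has total variation at most `V` stays within `V * |b - a|` of
an affine function. -/
theorem exists_norm_sub_sub_smul_le {F : Type*} [NormedAddCommGroup F]
    [NormedSpace ℝ F] [FiniteDimensional ℝ F] {h : ℝ → F} {V : ℝ} (hV : 0 ≤ V)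
    (hc : Continuous h) (hs : {x | ¬ DifferentiableAt ℝ h x}.Finite)
    (hvar : eVariationOn (deriv h) {x | DifferentiableAt ℝ h x} ≤ ENNReal.ofReal V) :
    ∃ v : F, ∀ a b : ℝ, ‖h b - h a - (b - a) • v‖ ≤ V * |b - a| := by
  obtain ⟨x₀, hx₀⟩ : ∃ x₀, DifferentiableAt ℝ h x₀ := by
    obtain ⟨x, hx⟩ := hs.infinite_compl.nonempty
    exact ⟨x, not_not.mp hx⟩
  refine ⟨deriv h x₀, fun a b => ?_⟩
  have hd : ∀ x, DifferentiableAt ℝ h x →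
      HasDerivAt (fun y => h y - y • deriv h x₀) (deriv h x - deriv h x₀) x := fun x hx => by
    have := hx.hasDerivAt.sub ((hasDerivAt_id x).smul_const (deriv h x₀))
    rwa [one_smul] at this
  have := norm_sub_le_of_norm_deriv_le_off_countable (M := V) (h := fun y => h y - y • deriv h x₀)
    (by fun_prop) hs.countable (fun x hx => (hd x (not_not.mp hx)).differentiableAt)
    (fun x hx => ?_) a b
  · convert this using 2
    simp only [sub_smul]
    abel
  · rw [(hd x (not_not.mp hx)).deriv, ← dist_eq_norm]
    have := (eVariationOn.edist_le (deriv h) (not_not.mp hx : x ∈ {x | DifferentiableAt ℝ h x})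
      hx₀).trans hvar
    rwa [edist_dist, ENNReal.ofReal_le_ofReal_iff hV] at this

theorem eVariationOn_insert_le {F : Type*} [PseudoEMetricSpace F] {f : ℝ → F} {s : Set ℝ} {a : ℝ}
    {c : ℕ → ℝ} (hcs : ∀ k, c k ∈ s) (hac : ∀ k, a < c k) (hc : Tendsto c atTop (nhds a))
    (hf : Tendsto (fun k => f (c k)) atTop (nhds (f a))) :
    eVariationOn f (insert a s) ≤ eVariationOn f s := by
  let φ : ℕ → ℝ → ℝ := fun k y => if a ≤ y then max y (c k) else y
  refine le_of_forall_lt fun v hv => ?_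
  have hlim : ∀ x ∈ insert a s, Tendsto (fun k => (f ∘ φ k) x) atTop (nhds (f x)) := by
    intro x _
    rcases lt_trichotomy x a with h | rfl | h
    · simpa [φ, not_le.mpr h] using tendsto_const_nhds
    · simpa [φ, max_eq_right (hac _).le] using hf
    · refine tendsto_const_nhds.congr' ?_
      filter_upwards [hc.eventually (gt_mem_nhds h)] with k hk
      simp [φ, h.le, max_eq_left hk.le]
  obtain ⟨k, hk⟩ := (eVariationOn.lowerSemicontinuous_aux hlim hv).exists
  refine hk.trans_le (eVariationOn.comp_le_of_monotoneOn f (φ k) ?_ ?_)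
  · intro x _ y _ hxy
    simp only [φ]
    split_ifs with h1 h2 h2
    · exact max_le_max_right _ hxy
    · exact absurd (h1.trans hxy) h2
    · exact hxy.trans (le_max_left _ _)
    · exact hxy
  · intro x hx
    simp only [φ]
    split_ifs with h1
    · rcases hx with rfl | hx
      · rw [max_eq_right (hac k).le]; exact hcs k
      · rcases max_choice x (c k) with h | h <;> rw [h]
        exacts [hx, hcs k]
    · exact hx.resolve_left (fun h => h1 h.ge)

/-- The derivative at any point is a limit of derivatives at nearby points on the right. -/
theorem exists_seq_deriv_tendsto {g : ℝ → ℝ} {s : Set ℝ} (hc : Continuous g) (hs : s.Finite)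
    (hd : ∀ x ∉ s, DifferentiableAt ℝ g x) {a : ℝ} (ha : DifferentiableAt ℝ g a) :
    ∃ c : ℕ → ℝ, (∀ k, c k ∉ s) ∧ (∀ k, a < c k) ∧ Tendsto c atTop (nhds a) ∧
      Tendsto (fun k => deriv g (c k)) atTop (nhds (deriv g a)) := by
  obtain ⟨δ, hδ, hδs⟩ : ∃ δ > 0, ∀ x ∈ Ioo a (a + δ), x ∉ s := by
    have h1 : (s \ {a})ᶜ ∈ nhds a :=
      (hs.subset sdiff_subset).isClosed.isOpen_compl.mem_nhds (by simp)
    obtain ⟨δ, hδ, hb⟩ := Metric.mem_nhds_iff.mp h1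
    refine ⟨δ, hδ, fun x hx hxs => ?_⟩
    refine hb (?_ : x ∈ Metric.ball a δ) ⟨hxs, hx.1.ne'⟩
    rw [Metric.mem_ball, Real.dist_eq, abs_of_pos (by linarith [hx.1])]
    linarith [hx.2]
  obtain ⟨u, -, hu, hulim⟩ := exists_seq_strictAnti_tendsto' (show a < a + δ by linarith)
  have key : ∀ k, ∃ c ∈ Ioo a (u k), deriv g c = (g (u k) - g a) / (u k - a) := fun k =>
    exists_deriv_eq_slope g (hu k).1 hc.continuousOn fun x hx =>
      (hd x (hδs x ⟨hx.1, hx.2.trans (hu k).2⟩)).differentiableWithinAt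
  choose c hcm hceq using key
  refine ⟨c, fun k => hδs _ ⟨(hcm k).1, (hcm k).2.trans (hu k).2⟩, fun k => (hcm k).1,
    tendsto_of_tendsto_of_tendsto_of_le_of_le tendsto_const_nhds hulim
      (fun k => (hcm k).1.le) (fun k => (hcm k).2.le), ?_⟩
  simp only [hceq]
  have := (hasDerivAt_iff_tendsto_slope.mp ha.hasDerivAt).comp
    (tendsto_nhdsWithin_iff.mpr ⟨hulim, .of_forall fun k => (hu k).1.ne'⟩)
  refine this.congr fun k => ?_
  simp [slope_def_field]

theorem eVariationOn_deriv_le_of_finite {g : ℝ → ℝ} {s : Set ℝ} (hc : Continuous g)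
    (hs : s.Finite) (hd : ∀ x ∉ s, DifferentiableAt ℝ g x) :
    eVariationOn (deriv g) {x | DifferentiableAt ℝ g x} ≤ eVariationOn (deriv g) sᶜ := by
  have key : ∀ u : Set ℝ, u.Finite → u ⊆ {x | DifferentiableAt ℝ g x} →
      eVariationOn (deriv g) (u ∪ sᶜ) ≤ eVariationOn (deriv g) sᶜ := by
    intro u hu
    induction u, hu using Set.Finite.induction_on with
    | empty => simp
    | @insert a u _ _ ih =>
      intro hsub
      obtain ⟨c, h1, h2, h3, h4⟩ := exists_seq_deriv_tendsto hc hs hd (hsub (mem_insert a u))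
      rw [insert_union]
      exact (eVariationOn_insert_le (fun k => Or.inr (h1 k)) h2 h3 h4).trans
        (ih ((subset_insert _ _).trans hsub))
  refine (eVariationOn.mono _ ?_).trans
    (key (s ∩ {x | DifferentiableAt ℝ g x}) (hs.inter_of_left _) inter_subset_right)
  intro x hx
  by_cases h : x ∈ s
  exacts [Or.inl ⟨h, hx⟩, Or.inr h]

section LineRestrictions

variable {E F : Type*} [NormedAddCommGroup E] [NormedSpace ℝ E] [NormedAddCommGroup F]
  [NormedSpace ℝ F]

/-- Along every line, `f` stays within `V * |s - r|` of an affine function. -/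
def NearlyAffineOnLines (f : E → F) (V : ℝ) : Prop :=
  ∀ w b : E, ‖w‖ = 1 → ∃ v : F, ∀ r s : ℝ,
    ‖f (s • w + b) - f (r • w + b) - (s - r) • v‖ ≤ V * |s - r|

theorem NearlyAffineOnLines.norm_add_sub_two_smul_le {f : E → F} {V : ℝ}
    (hf : NearlyAffineOnLines f V) (m u : E) :
    ‖f (m + u) + f (m - u) - (2 : ℝ) • f m‖ ≤ 2 * V * ‖u‖ := by
  rcases eq_or_ne u 0 with rfl | hu
  · simp [two_smul]
  have hu' : ‖u‖ ≠ 0 := norm_ne_zero_iff.mpr hu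
  obtain ⟨v, hv⟩ := hf (‖u‖⁻¹ • u) m (by simp [norm_smul, hu'])
  have h1 := hv 0 ‖u‖
  have h2 := hv 0 (-‖u‖)
  simp only [smul_smul, mul_inv_cancel₀ hu', one_smul, zero_smul, zero_add, sub_zero, neg_mul,
    neg_smul, abs_neg, abs_norm, zero_mul] at h1 h2
  rw [add_comm u m] at h1
  rw [neg_add_eq_sub] at h2
  calc _ = ‖(f (m + u) - f m - ‖u‖ • v) + (f (m - u) - f m - -(‖u‖ • v))‖ := by
        congr 1; rw [two_smul]; abel
    _ ≤ _ := (norm_add_le _ _).trans (by linarith)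

theorem NearlyAffineOnLines.exists_norm_le {ι : Type*} [Fintype ι]
    {f : EuclideanSpace ℝ ι → F} {V : ℝ} (hV : 0 ≤ V) (hf : NearlyAffineOnLines f V) :
    ∃ C, 0 ≤ C ∧ ∀ x, ‖f x‖ ≤ C * (1 + ‖x‖) := by
  classical
  suffices H : ∀ S : Finset ι, ∃ C, 0 ≤ C ∧ ∀ x : EuclideanSpace ℝ ι, (∀ i ∉ S, x i = 0) →
      ‖f x‖ ≤ C * (1 + ‖x‖) by
    obtain ⟨C, hC, h⟩ := H Finset.univ
    exact ⟨C, hC, fun x => h x (by simp)⟩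
  intro S
  induction S using Finset.induction_on with
  | empty =>
    refine ⟨‖f 0‖, norm_nonneg _, fun x hx => ?_⟩
    obtain rfl : x = 0 := by ext i; simpa using hx i
    simp
  | insert a S ha ih =>
    obtain ⟨C, hC, h⟩ := ih
    let e : EuclideanSpace ℝ ι := EuclideanSpace.single a 1
    have he : ‖e‖ = 1 := by simp [e]
    obtain ⟨v, hv⟩ := hf e 0 he
    have haxis : ∀ r : ℝ, ‖f (r • e)‖ ≤ ‖f 0‖ + (‖v‖ + V) * |r| := fun r => by
      have h1 := hv 0 r
      simp only [add_zero, zero_smul, sub_zero] at h1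
      have h2 : f (r • e) = f 0 + r • v + (f (r • e) - f 0 - r • v) := by abel
      rw [h2]
      refine (norm_add₃_le).trans ?_
      rw [norm_smul, Real.norm_eq_abs]
      linarith
    refine ⟨C + ‖f 0‖ + ‖v‖ + 3 * V, by positivity, fun x hx => ?_⟩
    let y : EuclideanSpace ℝ ι := x - x a • e
    have hya : y a = 0 := by simp [y, e]
    have hyS : ∀ i ∉ S, ((2 : ℝ) • y) i = 0 := fun i hi => by
      by_cases hia : i = a
      · subst hia; simp [hya]
      · have : x i = 0 := hx i (by simp [hia, hi])
        simp [y, e, hia, this]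
    have hxa : |x a| ≤ ‖x‖ := by simpa using PiLp.norm_apply_le x a
    have hy : ‖y‖ ≤ ‖x‖ := by
      refine (sq_le_sq₀ (norm_nonneg _) (norm_nonneg _)).mp ?_
      rw [EuclideanSpace.real_norm_sq_eq, EuclideanSpace.real_norm_sq_eq]
      refine Finset.sum_le_sum fun i _ => ?_
      by_cases hia : i = a
      · subst hia; simpa [hya] using sq_nonneg (x i)
      · simp [y, e, hia]
    have h2y := h _ hyS
    have h2a := haxis (2 * x a)
    have hmid := hf.norm_add_sub_two_smul_le x (y - x a • e)
    have e1 : x + (y - x a • e) = (2 : ℝ) • y := by simp only [y, two_smul]; abel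
    have e2 : x - (y - x a • e) = (2 * x a) • e := by
      simp only [y, two_mul, add_smul]; abel
    rw [e1, e2] at hmid
    have hu : ‖y - x a • e‖ ≤ 2 * ‖x‖ := by
      refine (norm_sub_le _ _).trans ?_
      rw [norm_smul, he, Real.norm_eq_abs]; linarith
    have h2f : (2 : ℝ) * ‖f x‖ ≤ ‖f ((2 : ℝ) • y)‖ + ‖f ((2 * x a) • e)‖ + 2 * V * (2 * ‖x‖) := by
      have : (2 : ℝ) * ‖f x‖ = ‖(2 : ℝ) • f x‖ := by rw [norm_smul]; norm_num
      rw [this]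
      have h3 := norm_le_norm_add_norm_sub (f ((2 : ℝ) • y) + f ((2 * x a) • e)) ((2 : ℝ) • f x)
      have h4 := norm_add_le (f ((2 : ℝ) • y)) (f ((2 * x a) • e))
      have h5 : 2 * V * ‖y - x a • e‖ ≤ 2 * V * (2 * ‖x‖) := by gcongr
      linarith
    rw [norm_smul, Real.norm_eq_abs, abs_two] at h2y
    rw [abs_mul, abs_two] at h2a
    have h6 : C * (1 + 2 * ‖y‖) ≤ C * (1 + 2 * ‖x‖) := by gcongr
    have h7 : (‖v‖ + V) * (2 * |x a|) ≤ (‖v‖ + V) * (2 * ‖x‖) := by gcongr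
    have h8 : 0 ≤ ‖f 0‖ * ‖x‖ := by positivity
    nlinarith [norm_nonneg v, norm_nonneg (f 0)]

theorem NearlyAffineOnLines.continuous {f : E → F} {V C : ℝ} (hC : 0 ≤ C)
    (hf : NearlyAffineOnLines f V) (hgrowth : ∀ x, ‖f x‖ ≤ C * (1 + ‖x‖)) :
    Continuous f := by
  refine (LipschitzWith.of_dist_le' (K := 3 * C + 2 * V) fun q p => ?_).continuous
  rw [dist_eq_norm, dist_eq_norm]
  rcases eq_or_ne q p with rfl | hne
  · simp
  have hu : ‖q - p‖ ≠ 0 := norm_ne_zero_iff.mpr (sub_ne_zero.mpr hne)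
  set w := ‖q - p‖⁻¹ • (q - p) with hw
  have hw1 : ‖w‖ = 1 := by simp [hw, norm_smul, hu]
  obtain ⟨v, hv⟩ := hf w p hw1
  have hv_le : ‖v‖ ≤ 3 * C + V := by
    set S := 1 + ‖p‖ with hS
    have hS0 : 0 < S := by positivity
    have h1 := hv 0 S
    simp only [zero_smul, zero_add, sub_zero, abs_of_pos hS0] at h1
    have h2 := norm_le_norm_add_norm_sub (f (S • w + p) - f p) (S • v)
    rw [norm_smul, Real.norm_eq_abs, abs_of_pos hS0] at h2
    have h3 := norm_sub_le (f (S • w + p)) (f p)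
    have h4 : ‖S • w + p‖ ≤ S + ‖p‖ := by
      refine (norm_add_le _ _).trans ?_
      rw [norm_smul, hw1, Real.norm_eq_abs, abs_of_pos hS0, mul_one]
    have h5 := hgrowth (S • w + p)
    have h6 := hgrowth p
    have h7 : C * (1 + ‖S • w + p‖) ≤ C * (1 + (S + ‖p‖)) := by gcongr
    have h8 : S * ‖v‖ ≤ S * (3 * C + V) := by
      have : C * (1 + (S + ‖p‖)) + C * (1 + ‖p‖) = 3 * C * S := by rw [hS]; ring
      linarith
    exact le_of_mul_le_mul_left h8 hS0
  have h1 := hv 0 ‖q - p‖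
  have hqp : ‖q - p‖ • w = q - p := by rw [hw, smul_smul, mul_inv_cancel₀ hu, one_smul]
  simp only [hqp, zero_smul, zero_add, sub_zero, abs_norm, sub_add_cancel] at h1
  have h2 := norm_le_norm_add_norm_sub' (f q - f p) (‖q - p‖ • v)
  rw [norm_smul, norm_norm] at h2
  nlinarith [norm_nonneg (q - p)]

end LineRestrictions
section Gaussian

theorem gaussD_pos (x : ℝ) {σ : ℝ} (hσ : 0 < σ) : 0 < gaussD x σ := by
  unfold gaussD; positivity

theorem contDiff_gaussD (σ : ℝ) : ContDiff ℝ 2 (fun x => gaussD x σ) := by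
  unfold gaussD; fun_prop

theorem gaussD_sub_eq_gaussianPDFReal {t : ℝ} (ht : 0 < t) (c x : ℝ) :
    gaussD (x - c) (√t) = ProbabilityTheory.gaussianPDFReal c t.toNNReal x := by
  unfold gaussD ProbabilityTheory.gaussianPDFReal
  rw [Real.sq_sqrt ht.le, ← Real.sqrt_mul (by positivity), Real.coe_toNNReal t ht.le]

theorem hasDerivAt_gaussD_sub {t : ℝ} (ht : 0 < t) (c x : ℝ) :
    HasDerivAt (fun y => gaussD (y - c) (√t)) (-(x - c) / t * gaussD (x - c) (√t)) x := by
  unfold gaussD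
  rw [Real.sq_sqrt ht.le]
  have h1 : HasDerivAt (fun y : ℝ => -(y - c) ^ 2 / (2 * t)) (-(x - c) / t) x := by
    convert! ((((hasDerivAt_id x).sub_const c).pow 2).neg.div_const (2 * t)) using 1
    simp; field_simp; ring
  convert! (h1.exp.const_mul ((√(2 * π) * √t)⁻¹)) using 1
  ring

theorem integrable_one_add_sq_mul_gaussD_sub {t : ℝ} (ht : 0 < t) (c : ℝ) :
    Integrable (fun x => (1 + x ^ 2) * gaussD (x - c) (√t)) := by
  have hv : t.toNNReal ≠ 0 := (Real.toNNReal_pos.mpr ht).ne'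
  have h1 : Integrable (fun x : ℝ => 1 + x ^ 2) (ProbabilityTheory.gaussianReal c t.toNNReal) :=
    (integrable_const 1).add
      (ProbabilityTheory.memLp_id_gaussianReal (μ := c) (v := t.toNNReal) 2).integrable_sq
  rw [ProbabilityTheory.gaussianReal_of_var_ne_zero c hv,
    integrable_withDensity_iff_integrable_smul' (ProbabilityTheory.measurable_gaussianPDF _ _)
      (.of_forall fun x => ProbabilityTheory.gaussianPDF_lt_top)] at h1
  refine h1.congr (.of_forall fun x => ?_)
  simp only [ProbabilityTheory.toReal_gaussianPDF, gaussD_sub_eq_gaussianPDFReal ht, smul_eq_mul,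
    mul_comm]

theorem integral_gaussD {t : ℝ} (ht : 0 < t) : ∫ x, gaussD x (√t) = 1 := by
  have hv : t.toNNReal ≠ 0 := (Real.toNNReal_pos.mpr ht).ne'
  rw [← ProbabilityTheory.integral_gaussianPDFReal_eq_one 0 hv]
  simp only [← gaussD_sub_eq_gaussianPDFReal ht, sub_zero]

variable {n : ℕ} {D t : ℝ}

theorem pEmp_pos (hn : 0 < n) (ht : 0 < t) (x : ℝ) : 0 < pEmp n D t x := by
  unfold pEmp
  have : (Finset.Icc 1 n).Nonempty := Finset.nonempty_Icc.mpr hn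
  have := Finset.sum_pos (fun k _ => gaussD_pos (x - trainPt n D k) (Real.sqrt_pos.mpr ht)) this
  positivity

theorem contDiff_pEmp : ContDiff ℝ 2 (pEmp n D t) :=
  contDiff_const.mul (ContDiff.sum fun _ _ => (contDiff_gaussD _).comp (by fun_prop))

theorem contDiff_scoreEmp (hn : 0 < n) (ht : 0 < t) : ContDiff ℝ 1 (scoreEmp n D t) :=
  (contDiff_pEmp.log fun x => (pEmp_pos hn ht x).ne').deriv'

theorem hasDerivAt_log_pEmp (hn : 0 < n) (ht : 0 < t) (x : ℝ) :
    HasDerivAt (fun y => Real.log (pEmp n D t y)) (scoreEmp n D t x) x :=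
  ((contDiff_pEmp.log fun x => (pEmp_pos hn ht x).ne').differentiable (by norm_num) x).hasDerivAt

theorem exists_abs_scoreEmp_le (hn : 0 < n) (ht : 0 < t) :
    ∃ A, 0 ≤ A ∧ ∀ x, |scoreEmp n D t x| ≤ A * (1 + |x|) := by
  set Y := ∑ k ∈ Finset.Icc 1 n, |trainPt n D k| with hY
  have hY0 : 0 ≤ Y := Finset.sum_nonneg fun _ _ => abs_nonneg _
  refine ⟨(1 + Y) / t, by positivity, fun x => ?_⟩
  have hp := pEmp_pos (D := D) hn ht x
  have hder : HasDerivAt (pEmp n D t) ((1 / (n : ℝ)) * ∑ k ∈ Finset.Icc 1 n,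
      -(x - trainPt n D k) / t * gaussD (x - trainPt n D k) (√t)) x :=
    (HasDerivAt.fun_sum fun k _ => hasDerivAt_gaussD_sub ht (trainPt n D k) x).const_mul _
  rw [(hasDerivAt_log_pEmp hn ht x).unique (hder.log hp.ne'), abs_div, abs_of_pos hp,
    div_le_iff₀ hp, abs_mul, abs_of_nonneg (by positivity : 0 ≤ 1 / (n : ℝ))]
  have : |∑ k ∈ Finset.Icc 1 n, -(x - trainPt n D k) / t * gaussD (x - trainPt n D k) (√t)|
      ≤ (1 + Y) / t * (1 + |x|) * ∑ k ∈ Finset.Icc 1 n, gaussD (x - trainPt n D k) (√t) := by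
    rw [Finset.mul_sum]
    refine (Finset.abs_sum_le_sum_abs _ _).trans (Finset.sum_le_sum fun k hk => ?_)
    have hg := gaussD_pos (x - trainPt n D k) (Real.sqrt_pos.mpr ht)
    rw [abs_mul, abs_of_pos hg, abs_div, abs_neg, abs_of_pos ht]
    refine mul_le_mul_of_nonneg_right ?_ hg.le
    rw [div_mul_eq_mul_div]
    gcongr
    have h1 : |trainPt n D k| ≤ Y :=
      Finset.single_le_sum (f := fun k => |trainPt n D k|) (fun _ _ => abs_nonneg _) hk
    have h2 := abs_sub x (trainPt n D k)
    nlinarith [abs_nonneg x]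
  calc _ ≤ 1 / (n : ℝ) * ((1 + Y) / t * (1 + |x|) *
        ∑ k ∈ Finset.Icc 1 n, gaussD (x - trainPt n D k) (√t)) := by gcongr
    _ = _ := by unfold pEmp; ring

theorem integrable_one_add_sq_mul_pEmp (ht : 0 < t) :
    Integrable (fun x => (1 + x ^ 2) * pEmp n D t x) := by
  have := (integrable_finsetSum (Finset.Icc 1 n) fun k _ =>
    integrable_one_add_sq_mul_gaussD_sub ht (trainPt n D k)).const_mul (1 / (n : ℝ))
  refine this.congr (.of_forall fun x => ?_)
  simp only [pEmp, ← Finset.mul_sum]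
  ring

end Gaussian

section Product

theorem one_add_sum_le_prod_one_add {ι : Type*} (S : Finset ι) {a : ι → ℝ} (ha : ∀ i, 0 ≤ a i) :
    1 + ∑ i ∈ S, a i ≤ ∏ i ∈ S, (1 + a i) := by
  classical
  induction S using Finset.induction_on with
  | empty => simp
  | insert i S hi ih =>
    rw [Finset.sum_insert hi, Finset.prod_insert hi]
    nlinarith [ha i, mul_nonneg (ha i) (Finset.sum_nonneg fun j (_ : j ∈ S) => ha j)]

variable {ι : Type*} [Fintype ι]

theorem hasGradientAt_log_prod {q s : ι → ℝ → ℝ} (hq : ∀ i x, q i x ≠ 0)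
    (hs : ∀ i x, HasDerivAt (fun y => Real.log (q i y)) (s i x) x) (x : EuclideanSpace ℝ ι) :
    HasGradientAt (fun y : EuclideanSpace ℝ ι => Real.log (∏ i, q i (y i)))
      (WithLp.toLp 2 fun i => s i (x i)) x := by
  rw [hasGradientAt_iff_hasFDerivAt]
  simp only [Real.log_prod fun i _ => hq i _]
  have h := HasFDerivAt.fun_sum (u := Finset.univ) fun i (_ : i ∈ Finset.univ) =>
    (hs i (x i)).comp_hasFDerivAt x
      ((EuclideanSpace.proj (𝕜 := ℝ) i : EuclideanSpace ℝ ι →L[ℝ] ℝ).hasFDerivAt (x := x))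
  convert! h using 1
  ext y
  simp [PiLp.inner_apply, mul_comm]

theorem integrable_norm_sub_sq_mul_prod {q s : ι → ℝ → ℝ}
    {f : EuclideanSpace ℝ ι → EuclideanSpace ℝ ι} {A C : ℝ} (hf : Continuous f)
    (hfC : ∀ x, ‖f x‖ ≤ C * (1 + ‖x‖)) (hs : ∀ i, Continuous (s i))
    (hsA : ∀ i x, |s i x| ≤ A * (1 + |x|)) (hq : ∀ i, Continuous (q i)) (hq0 : ∀ i x, 0 ≤ q i x)
    (hqi : ∀ i, Integrable (fun x => (1 + x ^ 2) * q i x)) :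
    Integrable fun x => ‖f x - WithLp.toLp 2 fun i => s i (x i)‖ ^ 2 * ∏ i, q i (x i) := by
  set K := 4 * C ^ 2 + 4 * A ^ 2 * (Fintype.card ι + 1) with hK
  have hdom : Integrable fun x : EuclideanSpace ℝ ι => K * ∏ i, ((1 + x i ^ 2) * q i (x i)) := by
    refine Integrable.const_mul ?_ _
    exact (PiLp.volume_preserving_ofLp ι).integrable_comp_of_integrable
      (Integrable.fintype_prod (f := fun i x => (1 + x ^ 2) * q i x) hqi)
  refine hdom.mono' (Continuous.aestronglyMeasurable ?_) (.of_forall fun x => ?_)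
  · have : ∀ i, Continuous fun x : EuclideanSpace ℝ ι => s i (x i) := fun i =>
      (hs i).comp (by fun_prop)
    have h2 : ∀ i, Continuous fun x : EuclideanSpace ℝ ι => q i (x i) := fun i =>
      (hq i).comp (by fun_prop)
    fun_prop
  · have hprod : 0 ≤ ∏ i, q i (x i) := Finset.prod_nonneg fun i _ => hq0 i _
    rw [Real.norm_of_nonneg (by positivity), Finset.prod_mul_distrib, ← mul_assoc]
    refine mul_le_mul_of_nonneg_right ?_ hprod
    have h0 : 1 + ‖x‖ ^ 2 ≤ ∏ i, (1 + x i ^ 2) := by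
      rw [EuclideanSpace.real_norm_sq_eq]
      exact one_add_sum_le_prod_one_add _ fun i => sq_nonneg _
    have h1 : ‖f x‖ ^ 2 ≤ 2 * C ^ 2 * (1 + ‖x‖ ^ 2) := by
      have := pow_le_pow_left₀ (norm_nonneg _) (hfC x) 2
      nlinarith [mul_nonneg (sq_nonneg C) (sq_nonneg (1 - ‖x‖))]
    have h2 : ‖WithLp.toLp 2 fun i => s i (x i)‖ ^ 2
        ≤ 2 * A ^ 2 * (Fintype.card ι + 1) * (1 + ‖x‖ ^ 2) := by
      have : ∀ i, s i (x i) ^ 2 ≤ 2 * A ^ 2 * (1 + x i ^ 2) := fun i => by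
        have := pow_le_pow_left₀ (abs_nonneg _) (hsA i (x i)) 2
        rw [sq_abs] at this
        nlinarith [mul_nonneg (sq_nonneg A) (sq_nonneg (1 - |x i|)), sq_abs (x i)]
      rw [EuclideanSpace.real_norm_sq_eq]
      refine (Finset.sum_le_sum fun i _ => this i).trans ?_
      rw [← Finset.mul_sum, Finset.sum_add_distrib, ← EuclideanSpace.real_norm_sq_eq]
      simp only [Finset.sum_const, Finset.card_univ, nsmul_eq_mul, mul_one, mul_assoc]
      gcongr
      nlinarith [mul_nonneg (Nat.cast_nonneg (α := ℝ) (Fintype.card ι)) (sq_nonneg ‖x‖)]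
    have h3 := pow_le_pow_left₀ (norm_nonneg _)
      (norm_sub_le (f x) (WithLp.toLp 2 fun i => s i (x i))) 2
    have h4 : ‖f x - WithLp.toLp 2 fun i => s i (x i)‖ ^ 2 ≤ K * (1 + ‖x‖ ^ 2) := by
      nlinarith [sq_nonneg (‖f x‖ - ‖WithLp.toLp 2 fun i => s i (x i)‖)]
    exact h4.trans (by gcongr)

end Product

section Slices

variable {d : ℕ}

theorem measurePreserving_toLp_cons :
    MeasurePreserving (fun z : ℝ × (Fin d → ℝ) =>
      (WithLp.toLp 2 (Fin.cons z.1 z.2) : EuclideanSpace ℝ (Fin (d + 1)))) := by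
  have h := (PiLp.volume_preserving_toLp (Fin (d + 1))).comp
    (volume_preserving_piFinSuccAbove (fun _ : Fin (d + 1) => ℝ) 0).symm
  convert! h using 1
  ext z
  simp [MeasurableEquiv.piFinSuccAbove]

theorem measurableEmbedding_toLp_cons :
    MeasurableEmbedding (fun z : ℝ × (Fin d → ℝ) =>
      (WithLp.toLp 2 (Fin.cons z.1 z.2) : EuclideanSpace ℝ (Fin (d + 1)))) := by
  have h := (MeasurableEquiv.toLp 2 (Fin (d + 1) → ℝ)).measurableEmbedding.comp
    (MeasurableEquiv.piFinSuccAbove (fun _ : Fin (d + 1) => ℝ) 0).symm.measurableEmbedding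
  convert! h using 1
  ext z
  simp [MeasurableEquiv.piFinSuccAbove]

/-- If the weighted average of `∫ a, φ r a` over `r` is at most `∫ G < c`, some slice has
`∫ a, φ r a < c`. -/
theorem exists_slice_integral_lt {G : EuclideanSpace ℝ (Fin (d + 1)) → ℝ} (hG : Integrable G)
    {φ : (Fin d → ℝ) → ℝ → ℝ} {Q : (Fin d → ℝ) → ℝ} (hφ : ∀ r a, 0 ≤ φ r a) (hQ0 : ∀ r, 0 ≤ Q r)
    (hQ : Integrable Q) (hQ1 : ∫ r, Q r = 1)
    (hle : ∀ a r, φ r a * Q r ≤ G (WithLp.toLp 2 (Fin.cons a r))) {c : ℝ} (hc : ∫ x, G x < c) :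
    ∃ r, ∫ a, φ r a < c := by
  by_contra! hcon
  have hint : Integrable (fun z : ℝ × (Fin d → ℝ) => G (WithLp.toLp 2 (Fin.cons z.1 z.2)))
      ((volume : Measure ℝ).prod volume) :=
    measurePreserving_toLp_cons.integrable_comp_of_integrable hG
  have heq : ∫ x, G x = ∫ r : Fin d → ℝ, ∫ a : ℝ, G (WithLp.toLp 2 (Fin.cons a r)) := by
    rw [← measurePreserving_toLp_cons.integral_comp measurableEmbedding_toLp_cons]
    exact integral_prod_symm _ hint
  have hmono : ∫ r, c * Q r ≤ ∫ r : Fin d → ℝ, ∫ a : ℝ, G (WithLp.toLp 2 (Fin.cons a r)) := by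
    refine integral_mono_ae (hQ.const_mul c) hint.integral_prod_right ?_
    filter_upwards [hint.prod_left_ae] with r hr
    calc c * Q r ≤ (∫ a, φ r a) * Q r := mul_le_mul_of_nonneg_right (hcon r) (hQ0 r)
      _ = ∫ a, φ r a * Q r := (integral_mul_const _ _).symm
      _ ≤ _ := integral_mono_of_nonneg (.of_forall fun a => mul_nonneg (hφ r a) (hQ0 r)) hr
          (.of_forall fun a => hle a r)
  rw [integral_const_mul, hQ1, mul_one, ← heq] at hmono
  exact hc.not_ge hmono

end Slices

section Main

variable {n : ℕ} {D t : ℝ} {d : ℕ}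

/-- The one-dimensional factors of `pEmpD`. -/
noncomputable def pEmpFactor (n : ℕ) (D : ℝ) (d : ℕ) (t : ℝ) : Fin (d + 1) → ℝ → ℝ :=
  Fin.cons (pEmp n D t) fun _ x => gaussD x (√t)

/-- The coordinates of the score of `pEmpD`. -/
noncomputable def scoreFactor (n : ℕ) (D : ℝ) (d : ℕ) (t : ℝ) : Fin (d + 1) → ℝ → ℝ :=
  Fin.cons (scoreEmp n D t) fun _ x => -x / t

theorem pEmpD_eq_prod (x : EuclideanSpace ℝ (Fin (d + 1))) :
    pEmpD n D d t x = ∏ i, pEmpFactor n D d t i (x i) := by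
  rw [← Finset.mul_prod_erase _ _ (Finset.mem_univ 0), pEmpD]
  congr 1
  refine Finset.prod_congr rfl fun i hi => ?_
  obtain ⟨j, rfl⟩ := Fin.exists_succ_eq.mpr (Finset.ne_of_mem_erase hi)
  simp [pEmpFactor]

theorem gradient_log_pEmpD (hn : 0 < n) (ht : 0 < t) (x : EuclideanSpace ℝ (Fin (d + 1))) :
    gradient (fun y => Real.log (pEmpD n D d t y)) x =
      WithLp.toLp 2 fun i => scoreFactor n D d t i (x i) := by
  simp only [pEmpD_eq_prod]
  refine (hasGradientAt_log_prod (fun i y => ?_) (fun i y => ?_) x).gradient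
  · cases i using Fin.cases with
    | zero => exact (pEmp_pos hn ht y).ne'
    | succ j => exact (gaussD_pos y (Real.sqrt_pos.mpr ht)).ne'
  · cases i using Fin.cases with
    | zero => exact hasDerivAt_log_pEmp hn ht y
    | succ j =>
      have hg := (gaussD_pos y (Real.sqrt_pos.mpr ht)).ne'
      have h := (hasDerivAt_gaussD_sub ht 0 y).log (by simpa using hg)
      simpa [pEmpFactor, scoreFactor, hg] using h

theorem integrable_scoreLossD_integrand (hn : 0 < n) (ht : 0 < t) {V : ℝ} (hV : 0 ≤ V)
    {f : EuclideanSpace ℝ (Fin (d + 1)) → EuclideanSpace ℝ (Fin (d + 1))}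
    (hf : NearlyAffineOnLines f V) :
    Integrable fun x => ‖f x - gradient (fun y => Real.log (pEmpD n D d t y)) x‖ ^ 2 *
      pEmpD n D d t x := by
  obtain ⟨C, hC, hfC⟩ := hf.exists_norm_le hV
  obtain ⟨A, hA, hsA⟩ := exists_abs_scoreEmp_le (D := D) hn ht
  have heq : ∀ x, ‖f x - gradient (fun y => Real.log (pEmpD n D d t y)) x‖ ^ 2 *
      pEmpD n D d t x = ‖f x - WithLp.toLp 2 fun i => scoreFactor n D d t i (x i)‖ ^ 2 *
        ∏ i, pEmpFactor n D d t i (x i) := fun x => by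
    rw [gradient_log_pEmpD hn ht, pEmpD_eq_prod]
  rw [funext heq]
  refine integrable_norm_sub_sq_mul_prod (A := A + 1 / t) (hf.continuous hC hfC) hfC ?_ ?_ ?_ ?_ ?_
    <;> intro i <;> cases i using Fin.cases
  · exact (contDiff_scoreEmp hn ht).continuous
  · exact continuous_neg.div_const t
  · intro x
    refine (hsA x).trans ?_
    gcongr
    simp [ht.le]
  · intro x
    simp only [scoreFactor, Fin.cons_succ, abs_div, abs_neg, abs_of_pos ht]
    rw [div_eq_mul_one_div, mul_comm]
    gcongr <;> simp [hA]
  · exact contDiff_pEmp.continuous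
  · exact (contDiff_gaussD _).continuous
  · exact fun x => (pEmp_pos hn ht x).le
  · exact fun x => (gaussD_pos x (Real.sqrt_pos.mpr ht)).le
  · exact integrable_one_add_sq_mul_pEmp ht
  · simpa [pEmpFactor] using integrable_one_add_sq_mul_gaussD_sub ht 0

theorem nearlyAffineOnLines_of_RnsD_ne_top
    {f : EuclideanSpace ℝ (Fin (d + 1)) → EuclideanSpace ℝ (Fin (d + 1))}
    (hreg : ∀ (w b : EuclideanSpace ℝ (Fin (d + 1))), ‖w‖ = 1 →
      Continuous (fun x : ℝ => f (x • w + b)) ∧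
      {x : ℝ | ¬ DifferentiableAt ℝ (fun x : ℝ => f (x • w + b)) x}.Finite)
    (hR : RnsD d f ≠ ⊤) : NearlyAffineOnLines f (RnsD d f).toReal := fun w b hw =>
  exists_norm_sub_sub_smul_le ENNReal.toReal_nonneg (hreg w b hw).1 (hreg w b hw).2 <| by
    rw [ENNReal.ofReal_toReal hR]
    exact le_iSup₂_of_le w hw (le_iSup_of_le b le_rfl)

theorem hasDerivAt_euclidean_apply {ι : Type*} [Fintype ι] {h : ℝ → EuclideanSpace ℝ ι} {x : ℝ}
    (hx : DifferentiableAt ℝ h x) (i : ι) : HasDerivAt (fun x => h x i) (deriv h x i) x :=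
  (EuclideanSpace.proj i : EuclideanSpace ℝ ι →L[ℝ] ℝ).hasFDerivAt.comp_hasDerivAt x hx.hasDerivAt

/-- Coordinates of curves have smaller total variation of the derivative. -/
theorem Rns_apply_le {ι : Type*} [Fintype ι] {h : ℝ → EuclideanSpace ℝ ι} (hc : Continuous h)
    (hs : {x | ¬ DifferentiableAt ℝ h x}.Finite) (i : ι) :
    Rns (fun x => h x i) ≤ eVariationOn (deriv h) {x | DifferentiableAt ℝ h x} := by
  refine (eVariationOn_deriv_le_of_finite (by fun_prop) hs
    fun x hx => (hasDerivAt_euclidean_apply (not_not.mp hx) i).differentiableAt).trans ?_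
  have hset : {x | ¬ DifferentiableAt ℝ h x}ᶜ = {x | DifferentiableAt ℝ h x} := by
    ext; simp
  have hderiv : EqOn (deriv fun x => h x i) ((fun v : EuclideanSpace ℝ ι => v i) ∘ deriv h)
      {x | DifferentiableAt ℝ h x} := fun x hx => (hasDerivAt_euclidean_apply hx i).deriv
  rw [hset, eVariationOn.eq_of_eqOn hderiv]
  have hl : LipschitzOnWith 1 (fun v : EuclideanSpace ℝ ι => v i) univ :=
    (LipschitzWith.of_dist_le_mul fun x y => by
      simpa [dist_eq_norm] using PiLp.norm_apply_le (x - y) i).lipschitzOnWith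
  simpa using hl.comp_eVariationOn_le (mapsTo_univ (deriv h) _)

end Main

/-- from any `f⃗ : ℝ^{d+1} → ℝ^{d+1}` with regular line restrictions and
`L^{(d)}_t[f⃗] < ε` one can extract `g : ℝ → ℝ`, continuous and differentiable except at
finitely many points, with `L_t[g] < ε` and `R[g] ≤ R^{(d)}[f⃗]`. -/
theorem stmt_13 (n : ℕ) (hn : 2 ≤ n) (D : ℝ) (hD : 0 < D) (d : ℕ) (t : ℝ) (ht : 0 < t)
    (ε : ℝ) (hε : 0 < ε)
    (f : EuclideanSpace ℝ (Fin (d + 1)) → EuclideanSpace ℝ (Fin (d + 1)))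
    (hreg : ∀ (w b : EuclideanSpace ℝ (Fin (d + 1))), ‖w‖ = 1 →
      Continuous (fun x : ℝ => f (x • w + b)) ∧
      {x : ℝ | ¬ DifferentiableAt ℝ (fun x : ℝ => f (x • w + b)) x}.Finite)
    (hloss : scoreLossD n D d t f < ε) :
    ∃ g : ℝ → ℝ, Continuous g ∧ {x | ¬ DifferentiableAt ℝ g x}.Finite ∧
      scoreLoss n D t g < ε ∧ Rns g ≤ RnsD d f := by
  have hn0 : 0 < n := by omega
  rcases eq_or_ne (RnsD d f) ⊤ with hR | hR
  · have hs := contDiff_scoreEmp (D := D) hn0 ht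
    refine ⟨scoreEmp n D t, hs.continuous, ?_, by simpa [scoreLoss] using hε, hR ▸ le_top⟩
    convert finite_empty
    simpa [eq_empty_iff_forall_notMem] using fun x => hs.differentiable one_ne_zero x
  have hint := integrable_scoreLossD_integrand (D := D) hn0 ht ENNReal.toReal_nonneg
    (nearlyAffineOnLines_of_RnsD_ne_top hreg hR)
  let Q : (Fin d → ℝ) → ℝ := fun r => ∏ i, gaussD (r i) (√t)
  have hg0 : ∀ x, 0 ≤ gaussD x (√t) := fun x => (gaussD_pos x (Real.sqrt_pos.mpr ht)).le
  have hQ0 : ∀ r, 0 ≤ Q r := fun r => Finset.prod_nonneg fun i _ => hg0 _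
  have hQ1 : ∫ r, Q r = 1 := by
    simp only [Q]
    rw [integral_fintype_prod_volume_eq_prod fun (_ : Fin d) x => gaussD x (√t)]
    simp [integral_gaussD ht]
  have hQi : Integrable Q := by
    by_contra h
    simp [integral_undef h] at hQ1
  have hle : ∀ a r, |f (WithLp.toLp 2 (Fin.cons a r)) 0 - scoreEmp n D t a| ^ 2 * pEmp n D t a *
      Q r ≤ ‖f (WithLp.toLp 2 (Fin.cons a r)) - gradient (fun y => Real.log (pEmpD n D d t y))
        (WithLp.toLp 2 (Fin.cons a r))‖ ^ 2 * pEmpD n D d t (WithLp.toLp 2 (Fin.cons a r)) := by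
    intro a r
    rw [gradient_log_pEmpD hn0 ht, pEmpD_eq_prod, Fin.prod_univ_succ]
    simp only [pEmpFactor, Fin.cons_zero, Fin.cons_succ]
    rw [mul_assoc]
    refine mul_le_mul_of_nonneg_right (pow_le_pow_left₀ (abs_nonneg _) ?_ 2)
      (mul_nonneg (pEmp_pos hn0 ht a).le (hQ0 r))
    exact PiLp.norm_apply_le (f (WithLp.toLp 2 (Fin.cons a r)) -
      WithLp.toLp 2 fun i => scoreFactor n D d t i ((Fin.cons a r : Fin (d + 1) → ℝ) i)) 0
  obtain ⟨r, hr⟩ := exists_slice_integral_lt hint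
    (fun r a => mul_nonneg (by positivity) (pEmp_pos hn0 ht a).le) hQ0 hQi hQ1 hle
    ((lt_div_iff₀' ht).mpr hloss)
  let b : EuclideanSpace ℝ (Fin (d + 1)) := WithLp.toLp 2 (Fin.cons 0 r)
  let e : EuclideanSpace ℝ (Fin (d + 1)) := EuclideanSpace.single 0 1
  have he : ‖e‖ = 1 := by simp [e]
  have hline : ∀ a : ℝ, WithLp.toLp 2 (Fin.cons a r) = a • e + b := fun a => by
    ext i
    cases i using Fin.cases <;> simp [e, b]
  obtain ⟨hc, hfin⟩ := hreg e b he
  simp only [hline] at hr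
  have hc0 : Continuous fun a : ℝ => f (a • e + b) 0 :=
    (EuclideanSpace.proj 0 : EuclideanSpace ℝ (Fin (d + 1)) →L[ℝ] ℝ).continuous.comp hc
  refine ⟨fun a => f (a • e + b) 0, hc0, hfin.subset fun x hx hd => hx ?_,
    ?_, ?_⟩
  · exact (hasDerivAt_euclidean_apply hd 0).differentiableAt
  · rw [scoreLoss]
    exact (lt_div_iff₀' ht).mp hr
  · exact (Rns_apply_le hc hfin 0).trans
      (by unfold RnsD; exact le_iSup₂_of_le e he (le_iSup_of_le b le_rfl))
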